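/- arXiv:math/0608768 — 2 statements merged into one kernel-verified Lean document; each statement's English description precedes it below -/
import Mathlib

section
/- Let G be a finitely generated group that is virtually a free product: there is a finite-index subgroup H of G and groups G₁, G₂, each containing an element different from the identity, with H isomorphic as a group to the free product Monoid.Coprod G₁ G₂. Let Δ be a finite type with decidable equality and e : List Δ → G a surjective monoid homomorphism. Then the following are equivalent: (i) for every finite set W of words in List Δ, the predicate w ↦ (e w ∈ Submonoid.closure (e '' W)) is computable (ComputablePred); (ii) for every regular language L ⊆ List Δ, the predicate w ↦ (e w ∈ e '' L) is computable. -/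
/-- Any finite type with decidable equality is primcodable. -/
noncomputable instance (priority := 50) fintypePrimcodable {α : Type} [Fintype α] [DecidableEq α] :
    Primcodable α :=
  Primcodable.ofEquiv (Fin (Fintype.card α)) (Fintype.equivFin α)

universe u

section PingPong

variable {N X I : Type*} [Group N] [MulAction N X]

/-- The products `x p * φ h * (x q)⁻¹` which encode a transition from `p` to `q` labelled by `h`. -/
def transitionBlock (φ : N →* N) (x : I → N) (p : I) (h : N) (q : I) : N :=
  x p * φ h * (x q)⁻¹

theorem transitionBlock_mul (φ : N →* N) (x : I → N) (p q r : I) (h k : N) :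
    transitionBlock φ x p h q * transitionBlock φ x q k r = transitionBlock φ x p (h * k) r := by
  simp [transitionBlock, mul_assoc]

theorem transitionBlock_self_one (φ : N →* N) (x : I → N) (p : I) :
    transitionBlock φ x p 1 p = 1 := by
  simp [transitionBlock]

theorem transitionBlock_inv (φ : N →* N) (x : I → N) (p q : I) (h : N) :
    (transitionBlock φ x p h q)⁻¹ = transitionBlock φ x q h⁻¹ p := by
  simp [transitionBlock, mul_assoc]

/-- Nonempty products of nontrivial blocks satisfying `P` without matching neighbours, together
with the index of the first block. -/
inductive ReducedBlockProduct (φ : N →* N) (x : I → N) (P : I → N → I → Prop) : I → N → Prop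
  | single {p h q} (hP : P p h q) (hne : p ≠ q ∨ h ≠ 1) :
      ReducedBlockProduct φ x P p (transitionBlock φ x p h q)
  | cons {p h q p' t} (hP : P p h q) (hne : p ≠ q ∨ h ≠ 1) (hq : q ≠ p')
      (ht : ReducedBlockProduct φ x P p' t) :
      ReducedBlockProduct φ x P p (transitionBlock φ x p h q * t)

variable {φ : N →* N} {x : I → N} {P : I → N → I → Prop}

theorem ReducedBlockProduct.block_mul (trans : ∀ p h q k r, P p h q → P q k r → P p (h * k) r)
    {p p' : I} {h t : N} (hP : P p h p') (ht : ReducedBlockProduct φ x P p' t) :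
    transitionBlock φ x p h p' * t = 1 ∨
      ∃ r, ReducedBlockProduct φ x P r (transitionBlock φ x p h p' * t) := by
  cases ht with
  | @single _ k q hk hne =>
    rw [transitionBlock_mul]
    by_cases hc : p ≠ q ∨ h * k ≠ 1
    · exact .inr ⟨p, .single (trans _ _ _ _ _ hP hk) hc⟩
    · push Not at hc
      obtain ⟨rfl, hc⟩ := hc
      rw [hc, transitionBlock_self_one]
      exact .inl rfl
  | @cons _ k q p'' t hk hne hq ht =>
    rw [← mul_assoc, transitionBlock_mul]
    by_cases hc : p ≠ q ∨ h * k ≠ 1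
    · exact .inr ⟨p, .cons (trans _ _ _ _ _ hP hk) hc hq ht⟩
    · push Not at hc
      obtain ⟨rfl, hc⟩ := hc
      rw [hc, transitionBlock_self_one, one_mul]
      exact .inr ⟨_, ht⟩

theorem eq_one_or_reducedBlockProduct (trans : ∀ p h q k r, P p h q → P q k r → P p (h * k) r)
    {t : N} (ht : t ∈ Submonoid.closure {t | ∃ p h q, P p h q ∧ transitionBlock φ x p h q = t}) :
    t = 1 ∨ ∃ p, ReducedBlockProduct φ x P p t := by
  induction ht using Submonoid.closure_induction_left with
  | one => exact .inl rfl
  | mul_left s hs t _ ih =>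
    obtain ⟨p, h, q, hP, rfl⟩ := hs
    by_cases hc : p ≠ q ∨ h ≠ 1
    · obtain rfl | ⟨p', ht⟩ := ih
      · rw [mul_one]
        exact .inr ⟨p, .single hP hc⟩
      · by_cases hq : q = p'
        · subst hq
          exact ht.block_mul trans hP
        · exact .inr ⟨p, .cons hP hc hq ht⟩
    · push Not at hc
      obtain ⟨rfl, rfl⟩ := hc
      rwa [transitionBlock_self_one, one_mul]

/-- A ping-pong configuration for the elements `x p` and the endomorphism `φ`. -/
structure PingPongConfig (φ : N →* N) (x : I → N) (R : I → Set X) (Z : Set X) : Prop where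
  nonempty : Z.Nonempty
  notMem : ∀ {p y}, y ∈ R p → y ∉ Z
  eq_of_mem : ∀ {p q y}, y ∈ R p → y ∈ R q → p = q
  smul_mem : ∀ {p q y}, p ≠ q → y ∈ R q → x p • y ∈ R p
  inv_smul_mem : ∀ {p q y}, p ≠ q → y ∈ R q → (x p)⁻¹ • y ∈ R p
  smul_mem_of_base : ∀ {p y}, y ∈ Z → x p • y ∈ R p
  inv_smul_mem_of_base : ∀ {p y}, y ∈ Z → (x p)⁻¹ • y ∈ R p
  map_smul_mem : ∀ {h p y}, h ≠ 1 → y ∈ R p → φ h • y ∈ Z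

variable {R : I → Set X} {Z : Set X}

theorem PingPongConfig.block_smul_mem (H : PingPongConfig φ x R Z) {p q : I} {h : N} {y : X}
    (hne : p ≠ q ∨ h ≠ 1) (hy : y ∈ Z ∨ ∃ r, q ≠ r ∧ y ∈ R r) :
    transitionBlock φ x p h q • y ∈ R p := by
  have h1 : (x q)⁻¹ • y ∈ R q := by
    obtain hy | ⟨r, hr, hy⟩ := hy
    · exact H.inv_smul_mem_of_base hy
    · exact H.inv_smul_mem hr hy
  rw [transitionBlock, mul_smul, mul_smul]
  by_cases hh : h = 1
  · subst hh
    rw [map_one, one_smul]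
    exact H.smul_mem (by simpa using hne) h1
  · exact H.smul_mem_of_base (H.map_smul_mem hh h1)

theorem PingPongConfig.reduced_smul_mem (H : PingPongConfig φ x R Z) {p : I} {t : N}
    (ht : ReducedBlockProduct φ x P p t) {y : X} (hy : y ∈ Z) : t • y ∈ R p := by
  induction ht with
  | single _ hne => exact H.block_smul_mem hne (.inl hy)
  | cons _ hne hq _ ih =>
    rw [mul_smul]
    exact H.block_smul_mem hne (.inr ⟨_, hq, ih⟩)

theorem PingPongConfig.of_block_mem_closure (H : PingPongConfig φ x R Z)
    (refl : ∀ p, P p 1 p) (trans : ∀ p h q k r, P p h q → P q k r → P p (h * k) r)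
    {p q : I} {h : N} (ht : transitionBlock φ x p h q ∈
      Submonoid.closure {t | ∃ p h q, P p h q ∧ transitionBlock φ x p h q = t}) :
    P p h q := by
  obtain ⟨y, hy⟩ := H.nonempty
  by_cases hc : p ≠ q ∨ h ≠ 1
  · have hp := H.block_smul_mem hc (.inl hy)
    obtain h1 | ⟨p', hr⟩ := eq_one_or_reducedBlockProduct trans ht
    · rw [h1, one_smul] at hp
      exact absurd hy (H.notMem hp)
    · obtain rfl := H.eq_of_mem hp (H.reduced_smul_mem hr hy)
      generalize hs : transitionBlock φ x p h q = s at hr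
      cases hr with
      | @single _ k q' hk hne =>
        have h1 : transitionBlock φ x q (h⁻¹ * k) q' = 1 := by
          rw [← transitionBlock_mul φ x q p q', ← hs, ← transitionBlock_inv, inv_mul_cancel]
        by_cases hc' : q ≠ q' ∨ h⁻¹ * k ≠ 1
        · have := H.block_smul_mem hc' (.inl hy)
          rw [h1, one_smul] at this
          exact absurd hy (H.notMem this)
        · push Not at hc'
          obtain ⟨rfl, hc'⟩ := hc'
          rwa [inv_mul_eq_one.1 hc']
      | @cons _ k q' p' t hk hne hq' ht' =>
        have h1 : t = transitionBlock φ x q' (k⁻¹ * h) q := by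
          rw [← transitionBlock_mul φ x q' p q, hs, ← transitionBlock_inv, inv_mul_cancel_left]
        have h2 := H.reduced_smul_mem ht' hy
        by_cases hc' : q' ≠ q ∨ k⁻¹ * h ≠ 1
        · exact absurd (H.eq_of_mem (H.block_smul_mem hc' (.inl hy)) (h1 ▸ h2)) hq'
        · push Not at hc'
          obtain ⟨rfl, hc'⟩ := hc'
          rw [hc', transitionBlock_self_one] at h1
          rw [h1, one_smul] at h2
          exact absurd hy (H.notMem h2)
  · push Not at hc
    obtain ⟨rfl, rfl⟩ := hc
    exact refl p

end PingPong

/-- Finite systems of labelled transitions in `N` can be encoded by submonoids of `N`. -/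
def HasPathEncoding (N : Type*) [Group N] : Prop :=
  ∃ φ : N →* N, ∃ x : ℕ → N, ∀ (I : Type) (j : I → ℕ), Function.Injective j →
    ∀ P : I → N → I → Prop, (∀ p, P p 1 p) →
      (∀ p h q k r, P p h q → P q k r → P p (h * k) r) → ∀ p h q,
        transitionBlock φ (x ∘ j) p h q ∈
          Submonoid.closure {t | ∃ p h q, P p h q ∧ transitionBlock φ (x ∘ j) p h q = t} →
        P p h q

theorem HasPathEncoding.of_mulEquiv {N N' : Type*} [Group N] [Group N'] (f : N ≃* N')
    (h : HasPathEncoding N) : HasPathEncoding N' := by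
  obtain ⟨φ, x, H⟩ := h
  refine ⟨(f.toMonoidHom.comp φ).comp f.symm.toMonoidHom, f ∘ x, fun I j hj P refl trans p h q ht =>
    ?_⟩
  have key : ∀ p h q, transitionBlock ((f.toMonoidHom.comp φ).comp f.symm.toMonoidHom)
      ((f ∘ x) ∘ j) p h q = f (transitionBlock φ (x ∘ j) p (f.symm h) q) := fun p h q => by
    simp [transitionBlock]
  have := H I j hj (fun p h q => P p (f h) q) (by simpa using refl)
    (fun p h q k r h1 h2 => by simpa using trans _ _ _ _ _ h1 h2) p (f.symm h) q ?_
  · simpa using this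
  · rw [key] at ht
    have h2 := Submonoid.mem_map_of_mem f.symm.toMonoidHom ht
    rw [MonoidHom.map_mclosure] at h2
    refine Submonoid.closure_mono ?_ (by simpa using h2)
    rintro _ ⟨_, ⟨p, h, q, hP, rfl⟩, rfl⟩
    exact ⟨p, f.symm h, q, by simpa using hP, ((f.symm_apply_eq).2 (key p h q)).symm⟩

section FreeProduct

open Monoid

variable {G₁ G₂ : Type u} [Group G₁] [Group G₂]

/-- `AlternatingProduct i h` says that `h` is an alternating product of nontrivial elements of the
two factors whose first syllable is not in the left factor (`i = false`) or not in the right factor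
(`i = true`). -/
inductive AlternatingProduct : Bool → Coprod G₁ G₂ → Prop
  | one (i) : AlternatingProduct i 1
  | inl_mul {g h} (hg : g ≠ 1) (hh : AlternatingProduct false h) :
      AlternatingProduct true (Coprod.inl g * h)
  | inr_mul {g h} (hg : g ≠ 1) (hh : AlternatingProduct true h) :
      AlternatingProduct false (Coprod.inr g * h)

theorem AlternatingProduct.exists_inl_mul (g : G₁) {i : Bool} {h : Coprod G₁ G₂}
    (hh : AlternatingProduct i h) : ∃ i, AlternatingProduct i (Coprod.inl g * h) := by
  by_cases hg : g = 1
  · subst hg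
    exact ⟨i, by simpa using hh⟩
  have of_false : ∀ {h : Coprod G₁ G₂}, AlternatingProduct false h →
    ∃ i, AlternatingProduct i (Coprod.inl g * h) := fun hh => ⟨_, hh.inl_mul hg⟩
  cases hh with
  | one => exact of_false (.one _)
  | @inl_mul g' h hg' hh =>
    rw [← mul_assoc, ← map_mul]
    by_cases hgg : g * g' = 1
    · exact ⟨false, by simpa [hgg] using hh⟩
    · exact ⟨_, hh.inl_mul hgg⟩
  | inr_mul hg' hh => exact of_false (hh.inr_mul hg')

theorem AlternatingProduct.exists_inr_mul (g : G₂) {i : Bool} {h : Coprod G₁ G₂}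
    (hh : AlternatingProduct i h) : ∃ i, AlternatingProduct i (Coprod.inr g * h) := by
  by_cases hg : g = 1
  · subst hg
    exact ⟨i, by simpa using hh⟩
  have of_true : ∀ {h : Coprod G₁ G₂}, AlternatingProduct true h →
    ∃ i, AlternatingProduct i (Coprod.inr g * h) := fun hh => ⟨_, hh.inr_mul hg⟩
  cases hh with
  | one => exact of_true (.one _)
  | @inr_mul g' h hg' hh =>
    rw [← mul_assoc, ← map_mul]
    by_cases hgg : g * g' = 1
    · exact ⟨true, by simpa [hgg] using hh⟩
    · exact ⟨_, hh.inr_mul hgg⟩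
  | inl_mul hg' hh => exact of_true (hh.inl_mul hg')

theorem exists_alternatingProduct (h : Coprod G₁ G₂) : ∃ i, AlternatingProduct i h := by
  induction h using Coprod.induction_on' with
  | one => exact ⟨true, .one _⟩
  | inl_mul g h ih => exact ih.elim fun _ hi => hi.exists_inl_mul g
  | inr_mul g h ih => exact ih.elim fun _ hi => hi.exists_inr_mul g

/-- The two factors of a free product play ping-pong on the sets `U` and `V`. -/
structure FactorPingPong (G₁ G₂ : Type u) [Group G₁] [Group G₂]
    (X : Type*) [MulAction (Coprod G₁ G₂) X] (U V : Set X) : Prop where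
  disjoint : Disjoint U V
  nonempty : V.Nonempty
  inl_smul_mem : ∀ {g : G₁} {y : X}, g ≠ 1 → y ∈ V → (Coprod.inl g : Coprod G₁ G₂) • y ∈ U
  inr_smul_mem : ∀ {g : G₂} {y : X}, g ≠ 1 → y ∈ U → (Coprod.inr g : Coprod G₁ G₂) • y ∈ V

/-- The two factors as a family of groups indexed by `Bool`. -/
def boolFamily (G₁ G₂ : Type u) : Bool → Type u
  | false => G₁
  | true => G₂

instance (i : Bool) : Group (boolFamily G₁ G₂ i) :=
  match i with
  | false => inferInstanceAs (Group G₁)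
  | true => inferInstanceAs (Group G₂)

theorem Monoid.CoprodI.Word.fstIdx_of_smul {ι : Type*} {M : ι → Type*} [∀ i, Group (M i)]
    [DecidableEq ι] [∀ i, DecidableEq (M i)] {i : ι} {m : M i} (hm : m ≠ 1)
    {w : CoprodI.Word M} (hw : w.fstIdx ≠ some i) :
    (CoprodI.of m • w).fstIdx = some i := by
  rw [← CoprodI.Word.cons_eq_smul (h1 := hw) (h2 := hm), CoprodI.Word.fstIdx_cons]

theorem exists_factorPingPong (G₁ G₂ : Type u) [Group G₁] [Group G₂] (h₂ : ∃ g : G₂, g ≠ 1) :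
    ∃ (X : Type u) (_ : MulAction (Coprod G₁ G₂) X) (U V : Set X), FactorPingPong G₁ G₂ X U V := by
  classical
  let f : Coprod G₁ G₂ →* CoprodI (boolFamily G₁ G₂) :=
    Coprod.lift (CoprodI.of (M := boolFamily G₁ G₂) (i := false))
      (CoprodI.of (M := boolFamily G₁ G₂) (i := true))
  let _ : MulAction (Coprod G₁ G₂) (CoprodI.Word (boolFamily G₁ G₂)) := MulAction.compHom _ f
  have hl : ∀ (g : G₁) (w : CoprodI.Word (boolFamily G₁ G₂)),
      (Coprod.inl g : Coprod G₁ G₂) • w =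
        CoprodI.of (M := boolFamily G₁ G₂) (i := false) g • w := fun g w => by
    have hf : f (Coprod.inl g) = CoprodI.of (M := boolFamily G₁ G₂) (i := false) g :=
      Coprod.lift_apply_inl _ _ g
    rw [← hf]
    rfl
  have hr : ∀ (g : G₂) (w : CoprodI.Word (boolFamily G₁ G₂)),
      (Coprod.inr g : Coprod G₁ G₂) • w =
        CoprodI.of (M := boolFamily G₁ G₂) (i := true) g • w := fun g w => by
    have hf : f (Coprod.inr g) = CoprodI.of (M := boolFamily G₁ G₂) (i := true) g :=
      Coprod.lift_apply_inr _ _ g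
    rw [← hf]
    rfl
  refine ⟨CoprodI.Word (boolFamily G₁ G₂), inferInstance, {w | w.fstIdx = some false},
    {w | w.fstIdx = some true}, ?_, ?_, ?_, ?_⟩
  · rw [Set.disjoint_left]
    intro w h1 h2
    simp only [Set.mem_ofPred_eq] at h1 h2
    simp [h1] at h2
  · obtain ⟨g, hg⟩ := h₂
    refine ⟨CoprodI.of (M := boolFamily G₁ G₂) (i := true) g • CoprodI.Word.empty, ?_⟩
    exact CoprodI.Word.fstIdx_of_smul (M := boolFamily G₁ G₂) (i := true) hg
      (by simp [CoprodI.Word.fstIdx, CoprodI.Word.empty])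
  · intro g y hg hy
    rw [hl]
    exact CoprodI.Word.fstIdx_of_smul (M := boolFamily G₁ G₂) (i := false) hg
      (by simp only [Set.mem_ofPred_eq] at hy; simp [hy])
  · intro g y hg hy
    rw [hr]
    exact CoprodI.Word.fstIdx_of_smul (M := boolFamily G₁ G₂) (i := true) hg
      (by simp only [Set.mem_ofPred_eq] at hy; simp [hy])

/-- The words `(b a)ʲ c a` none of which is an initial segment of another one. -/
def antichainElement (a : G₁) (b c : G₂) (j : ℕ) : Coprod G₁ G₂ :=
  (Coprod.inr b * Coprod.inl a) ^ j * (Coprod.inr c * Coprod.inl a)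

namespace FactorPingPong

variable {X : Type*} [MulAction (Coprod G₁ G₂) X] {U V : Set X} {a : G₁} {b c : G₂}

theorem pow_smul_mem (H : FactorPingPong G₁ G₂ X U V) (ha : a ≠ 1) (hb : b ≠ 1) (m : ℕ) {y : X}
    (hy : y ∈ V) : ((Coprod.inr b * Coprod.inl a : Coprod G₁ G₂) ^ m) • y ∈ V := by
  induction m with
  | zero => simpa using hy
  | succ m ih =>
    rw [pow_succ', mul_smul, mul_smul]
    exact H.inr_smul_mem hb (H.inl_smul_mem ha ih)

theorem inv_pow_smul_mem (H : FactorPingPong G₁ G₂ X U V) (ha : a ≠ 1) (hb : b ≠ 1) (m : ℕ) {y : X}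
    (hy : y ∈ U) : (((Coprod.inr b * Coprod.inl a : Coprod G₁ G₂) ^ m)⁻¹) • y ∈ U := by
  induction m with
  | zero => simpa using hy
  | succ m ih =>
    rw [pow_succ, mul_inv_rev, mul_inv_rev, mul_smul, mul_smul, ← map_inv, ← map_inv]
    exact H.inl_smul_mem (inv_ne_one.2 ha) (H.inr_smul_mem (inv_ne_one.2 hb) ih)

theorem antichainElement_smul_mem (H : FactorPingPong G₁ G₂ X U V) (ha : a ≠ 1) (hb : b ≠ 1)
    (hc : c ≠ 1) (j : ℕ) {y : X} (hy : y ∈ V) : antichainElement a b c j • y ∈ V := by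
  rw [antichainElement, mul_smul, mul_smul]
  exact H.pow_smul_mem ha hb j (H.inr_smul_mem hc (H.inl_smul_mem ha hy))

theorem inv_antichainElement_smul_mem (H : FactorPingPong G₁ G₂ X U V) (ha : a ≠ 1) (hb : b ≠ 1)
    (hc : c ≠ 1) (hbc : b ≠ c) {j k : ℕ} (hjk : j ≠ k) {y : X} (hy : y ∈ V) :
    (antichainElement a b c j)⁻¹ • antichainElement a b c k • y ∈ U := by
  rw [smul_smul]
  obtain h | h := lt_or_gt_of_ne hjk
  · obtain ⟨m, rfl⟩ := Nat.exists_eq_add_of_lt h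
    have : (antichainElement a b c j)⁻¹ * antichainElement a b c (j + m + 1) =
        Coprod.inl a⁻¹ * (Coprod.inr (c⁻¹ * b) * (Coprod.inl a * antichainElement a b c m)) := by
      simp only [antichainElement, add_assoc, pow_add _ j, pow_succ', map_inv, map_mul]
      simp [mul_assoc]
    rw [this, mul_smul, mul_smul, mul_smul]
    exact H.inl_smul_mem (inv_ne_one.2 ha) (H.inr_smul_mem (by simpa [inv_mul_eq_one] using hbc.symm)
      (H.inl_smul_mem ha (H.antichainElement_smul_mem ha hb hc m hy)))
  · obtain ⟨m, rfl⟩ := Nat.exists_eq_add_of_lt h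
    have : (antichainElement a b c (k + m + 1))⁻¹ * antichainElement a b c k =
        Coprod.inl a⁻¹ * (Coprod.inr c⁻¹ * (((Coprod.inr b * Coprod.inl a) ^ m)⁻¹ *
          (Coprod.inl a⁻¹ * (Coprod.inr (b⁻¹ * c) * Coprod.inl a)))) := by
      simp only [antichainElement, add_assoc, pow_add _ k, pow_succ', map_inv, map_mul]
      simp [mul_assoc]
    rw [this, mul_smul, mul_smul, mul_smul, mul_smul, mul_smul]
    exact H.inl_smul_mem (inv_ne_one.2 ha) (H.inr_smul_mem (inv_ne_one.2 hc)
      (H.inv_pow_smul_mem ha hb m (H.inl_smul_mem (inv_ne_one.2 ha) (H.inr_smul_mem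
        (by simpa [inv_mul_eq_one] using hbc) (H.inl_smul_mem ha hy)))))

end FactorPingPong

theorem Monoid.Coprod.hasPathEncoding (h₁ : ∃ g : G₁, g ≠ 1) {b c : G₂} (hb : b ≠ 1)
    (hc : c ≠ 1) (hbc : b ≠ c) : HasPathEncoding (Coprod G₁ G₂) := by
  obtain ⟨a, ha⟩ := h₁
  obtain ⟨X, _, U, V, H⟩ := exists_factorPingPong G₁ G₂ ⟨b, hb⟩
  set D : ℕ → Coprod G₁ G₂ := antichainElement a b c with hD
  let R : ℕ → Set X := fun j => {y | (D j)⁻¹ • y ∈ V}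
  have hU : ∀ {j k : ℕ} {y : X}, j ≠ k → y ∈ R k → (D j)⁻¹ • y ∈ U := fun {j k y} hjk hy => by
    simpa only [hD, smul_inv_smul] using H.inv_antichainElement_smul_mem ha hb hc hbc hjk hy
  have hR : ∀ {j k : ℕ} {y : X}, y ∈ R j → y ∈ R k → j = k := fun {j k y} h1 h2 => by
    by_contra hjk
    exact Set.disjoint_left.1 H.disjoint (hU hjk h2) h1
  have conj_mem : ∀ {z : Coprod G₁ G₂}, (∀ y ∈ U, z • y ∈ V) → ∀ {j k : ℕ} {y : X}, j ≠ k →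
      y ∈ R k → MulAut.conj (D j) z • y ∈ R j := fun {z} hz {j k y} hjk hy => by
    change (D j)⁻¹ • _ ∈ V
    rw [MulAut.conj_apply, smul_smul, mul_assoc, inv_mul_cancel_left, mul_smul]
    exact hz _ (hU hjk hy)
  let φ : Coprod G₁ G₂ →* Coprod G₁ G₂ :=
    Coprod.lift ((MulAut.conj (D 0 * Coprod.inr b)).toMonoidHom.comp Coprod.inl)
      ((MulAut.conj (D 1)).toMonoidHom.comp Coprod.inr)
  have hinl : ∀ {g : G₁}, g ≠ 1 → ∀ {k : ℕ} {y : X}, 0 ≠ k → y ∈ R k →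
      φ (Coprod.inl g) • y ∈ R 0 := fun {g} hg {k y} hk hy => by
    have : φ (Coprod.inl g) =
        MulAut.conj (D 0) (Coprod.inr b * (Coprod.inl g * Coprod.inr b⁻¹)) := by
      simp [φ, mul_assoc]
    rw [this]
    refine conj_mem (fun y hy => ?_) hk hy
    rw [mul_smul, mul_smul]
    exact H.inr_smul_mem hb (H.inl_smul_mem hg (H.inr_smul_mem (inv_ne_one.2 hb) hy))
  have hinr : ∀ {g : G₂}, g ≠ 1 → ∀ {k : ℕ} {y : X}, 1 ≠ k → y ∈ R k →
      φ (Coprod.inr g) • y ∈ R 1 := fun {g} hg {k y} hk hy => by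
    have : φ (Coprod.inr g) = MulAut.conj (D 1) (Coprod.inr g) := by simp [φ]
    rw [this]
    exact conj_mem (fun y hy => H.inr_smul_mem hg hy) hk hy
  have hφ : ∀ {i h}, AlternatingProduct i h → h = 1 ∨
      ∀ {k : ℕ} {y : X}, y ∈ R (k + 2) → φ h • y ∈ R (if i then 0 else 1) := fun {i h} hh => by
    induction hh with
    | one => exact .inl rfl
    | inl_mul hg _ ih =>
      refine .inr fun {k y} hy => ?_
      obtain rfl | ih := ih
      · rw [mul_one]
        exact hinl hg (by simp) hy
      · rw [map_mul, mul_smul]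
        exact hinl hg (by simp) (ih hy)
    | inr_mul hg _ ih =>
      refine .inr fun {k y} hy => ?_
      obtain rfl | ih := ih
      · rw [mul_one]
        exact hinr hg (by simp) hy
      · rw [map_mul, mul_smul]
        exact hinr hg (by simp) (ih hy)
  have hx : ∀ {j k : ℕ} {y : X}, j ≠ k → y ∈ R k →
      MulAut.conj (D j) (Coprod.inr b) • y ∈ R j :=
    conj_mem fun y hy => H.inr_smul_mem hb hy
  have hx' : ∀ {j k : ℕ} {y : X}, j ≠ k → y ∈ R k →
      (MulAut.conj (D j) (Coprod.inr b))⁻¹ • y ∈ R j := fun {j k y} hjk hy => by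
    rw [← map_inv, ← map_inv]
    exact conj_mem (fun y hy => H.inr_smul_mem (inv_ne_one.2 hb) hy) hjk hy
  refine ⟨φ, fun j => MulAut.conj (D (j + 2)) (Coprod.inr b), fun I j hj P refl trans p h q ht =>
    PingPongConfig.of_block_mem_closure (X := X) (R := fun i => R (j i + 2)) (Z := R 0 ∪ R 1)
      ⟨?_, ?_, ?_, ?_, ?_, ?_, ?_, ?_⟩ refl trans ht⟩
  · obtain ⟨y, hy⟩ := H.nonempty
    exact ⟨D 0 • y, .inl (by simpa [R] using hy)⟩
  · rintro p y hp (hy | hy)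
    · simpa using hR hp hy
    · simpa using hR hp hy
  · exact fun h1 h2 => hj (by simpa using hR h1 h2)
  · exact fun hpq hy => hx (by simpa using hj.ne hpq) hy
  · exact fun hpq hy => hx' (by simpa using hj.ne hpq) hy
  · rintro p y (hy | hy)
    · exact hx (by simp) hy
    · exact hx (by simp) hy
  · rintro p y (hy | hy)
    · exact hx' (by simp) hy
    · exact hx' (by simp) hy
  · intro h p y hne hy
    obtain ⟨i, hi⟩ := exists_alternatingProduct h
    have := ((hφ hi).resolve_left hne) hy
    cases i
    · exact .inr this
    · exact .inl this

end FreeProduct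

section Computability

variable {α β σ : Type*} [Primcodable α] [Primcodable β] [Primcodable σ]

theorem ComputablePred.preimage {p : β → Prop} (hp : ComputablePred p) {f : α → β}
    (hf : Computable f) : ComputablePred fun a => p (f a) := by
  obtain ⟨_, h⟩ := hp
  exact ⟨fun a => inferInstanceAs (Decidable (p (f a))), h.comp hf⟩

theorem ComputablePred.conj {p q : α → Prop} (hp : ComputablePred p) (hq : ComputablePred q) :
    ComputablePred fun a => p a ∧ q a := by
  obtain ⟨_, hp⟩ := hp
  obtain ⟨_, hq⟩ := hq
  refine ⟨fun a => inferInstance, ?_⟩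
  exact (Primrec.and.to_comp.comp hp hq).of_eq fun a => by simp

theorem ComputablePred.disj {p q : α → Prop} (hp : ComputablePred p) (hq : ComputablePred q) :
    ComputablePred fun a => p a ∨ q a := by
  obtain ⟨_, hp⟩ := hp
  obtain ⟨_, hq⟩ := hq
  refine ⟨fun a => inferInstance, ?_⟩
  exact (Primrec.or.to_comp.comp hp hq).of_eq fun a => by simp

theorem ComputablePred.const_prop (p : Prop) : ComputablePred fun _ : α => p := by
  classical
  exact ⟨fun _ => inferInstance, Computable.const _⟩

theorem ComputablePred.exists_finite {ι : Type*} [Finite ι] {p : ι → α → Prop}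
    (hp : ∀ i, ComputablePred (p i)) : ComputablePred fun a => ∃ i, p i a := by
  classical
  have key : ∀ s : Set ι, s.Finite → ComputablePred fun a => ∃ i ∈ s, p i a := by
    intro s hs
    induction s, hs using Set.Finite.induction_on with
    | empty => exact (ComputablePred.const_prop False).of_eq fun a => by simp
    | @insert i _ _ _ ih => exact ((hp i).disj ih).of_eq fun a => by simp
  exact (key Set.univ Set.finite_univ).of_eq fun a => by simp

/-- Every predicate on a finite type is computable. -/
theorem ComputablePred.of_finite [Finite α] (p : α → Prop) : ComputablePred p := by
  classical
  exact ⟨fun _ => inferInstance, (Primrec.dom_finite _).to_comp⟩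

end Computability

section Transducer

/-- The output of a finite transducer reading a word from the state `s`. -/
def transduce {A S M : Type*} [Monoid M] (step : S → A → S) (lab : S → A → M) : S → List A → M
  | _, [] => 1
  | s, a :: w => lab s a * transduce step lab (step s a) w

variable {A S M : Type*} [Monoid M] {step : S → A → S} {lab : S → A → M}

@[simp]
theorem transduce_nil (s : S) : transduce step lab s [] = 1 := rfl

@[simp]
theorem transduce_cons (s : S) (a : A) (w : List A) :
    transduce step lab s (a :: w) = lab s a * transduce step lab (step s a) w := rfl

theorem transduce_append (s : S) (v w : List A) :
    transduce step lab s (v ++ w) =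
      transduce step lab s v * transduce step lab (v.foldl step s) w := by
  induction v generalizing s with
  | nil => simp
  | cons a v ih => simp [ih, mul_assoc]

theorem map_transduce {M' : Type*} [Monoid M'] (f : M →* M') (s : S) (w : List A) :
    f (transduce step lab s w) = transduce step (fun s a => f (lab s a)) s w := by
  induction w generalizing s with
  | nil => simp
  | cons a w ih => simp [ih]

theorem primrec_foldl_step [Finite A] [Finite S] [Primcodable A] [Primcodable S] (s : S) :
    Primrec fun w : List A => w.foldl step s :=
  Primrec.list_foldl Primrec.id (Primrec.const s)
    ((Primrec.dom_finite fun p : S × A => step p.1 p.2).comp Primrec.snd).to₂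

theorem primrec_transduce [Finite A] [Finite S] [Primcodable A] [Primcodable S] [Primcodable M]
    (hM : Primrec₂ fun x y : M => x * y) (s : S) :
    Primrec fun w : List A => transduce step lab s w := by
  have h : Primrec fun w : List A => w.foldl
      (fun (p : M × S) a => (p.1 * lab p.2 a, step p.2 a)) ((1 : M), s) :=
    Primrec.list_foldl (f := id) (g := fun _ => ((1 : M), s))
      (h := fun _ (q : (M × S) × A) => (q.1.1 * lab q.1.2 q.2, step q.1.2 q.2))
      Primrec.id (Primrec.const _) <| by
      have hS : Primrec fun x : List A × ((M × S) × A) => (x.2.1.2, x.2.2) :=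
        Primrec.pair (Primrec.snd.comp (Primrec.fst.comp Primrec.snd))
          (Primrec.snd.comp Primrec.snd)
      have hM' : Primrec fun x : List A × ((M × S) × A) => x.2.1.1 :=
        Primrec.fst.comp (Primrec.fst.comp Primrec.snd)
      have h₁ : Primrec fun x : List A × ((M × S) × A) => lab x.2.1.2 x.2.2 :=
        (Primrec.dom_finite fun p : S × A => lab p.1 p.2).comp hS
      have h₂ : Primrec fun x : List A × ((M × S) × A) => step x.2.1.2 x.2.2 :=
        (Primrec.dom_finite fun p : S × A => step p.1 p.2).comp hS
      exact Primrec.to₂ (Primrec.pair (hM.comp hM' h₁) h₂)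
  refine (Primrec.fst.comp h).of_eq fun w => ?_
  suffices ∀ (m : M) (s : S), w.foldl
      (fun (p : M × S) a => (p.1 * lab p.2 a, step p.2 a)) (m, s) =
      (m * transduce step lab s w, w.foldl step s) by simp [this]
  induction w with
  | nil => simp
  | cons a w ih => intro m s; simp [ih, mul_assoc]

end Transducer

section KleeneStar

variable {α : Type*}

theorem Language.kstar_isRegular_of_finite {W : Language α} (hW : Set.Finite W) :
    (KStar.kstar W).IsRegular := by
  apply Language.IsRegular.of_finite_range_leftQuotient
  set F : Set (List α) := insert [] (⋃ w ∈ W, {s | s ∈ w.tails}) with hF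
  have hFf : F.Finite := by
    refine (hW.biUnion fun w _ => ?_).insert _
    exact List.finite_toSet _
  refine ((hFf.powerset).image
    (fun T : Set (List α) => ({y | ∃ s ∈ T, ∃ v ∈ KStar.kstar W, y = s ++ v} : Language α))).subset ?_
  rintro _ ⟨x, rfl⟩
  refine ⟨{s ∈ F | x ++ s ∈ KStar.kstar W}, fun s hs => hs.1, ?_⟩
  ext y
  change (∃ s, (s ∈ F ∧ _) ∧ _) ↔ x ++ y ∈ KStar.kstar W
  constructor
  · rintro ⟨s, ⟨-, hs⟩, v, hv, rfl⟩
    rw [← List.append_assoc]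
    rw [Language.mem_kstar] at *
    obtain ⟨L, h1, hL⟩ := hs
    obtain ⟨K, rfl, hK⟩ := hv
    refine ⟨L ++ K, by simp [h1], ?_⟩
    simp only [List.mem_append]
    rintro y (h | h)
    exacts [hL y h, hK y h]
  · intro h
    obtain ⟨L, h, hL⟩ := Language.mem_kstar.1 h
    clear hFf
    induction L generalizing x with
    | nil =>
      simp only [List.flatten_nil, List.append_eq_nil_iff] at h
      refine ⟨[], ⟨Or.inl rfl, ?_⟩, y, ?_, by simp⟩
      · simpa [h.1] using Language.nil_mem_kstar W
      · simpa [h.2] using Language.nil_mem_kstar W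
    | cons w L ih =>
      have hw : w ∈ W := hL w (by simp)
      have hL' : ∀ y ∈ L, y ∈ W := fun y hy => hL y (by simp [hy])
      rw [List.flatten_cons, List.append_eq_append_iff] at h
      rcases h with ⟨s, rfl, hy⟩ | ⟨x', rfl, hy⟩
      · refine ⟨s, ⟨Or.inr ?_, ?_⟩, L.flatten, Language.mem_kstar.2 ⟨L, rfl, hL'⟩, hy⟩
        · simp only [Set.mem_iUnion]
          exact ⟨_, hw, by simp⟩
        · exact Language.mem_kstar.2 ⟨[x ++ s], by simp, by simpa using hw⟩
      · obtain ⟨s, ⟨hs, hs'⟩, v, hv, rfl⟩ :=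
          ih x' (Language.mem_kstar.2 ⟨L, hy.symm, hL'⟩) hy.symm hL'
        refine ⟨s, ⟨hs, ?_⟩, v, hv, rfl⟩
        obtain ⟨K, h1, hK⟩ := Language.mem_kstar.1 hs'
        refine Language.mem_kstar.2 ⟨w :: K, by simp [h1], ?_⟩
        simpa [hw] using hK

theorem Submonoid.closure_image_ofList {G : Type*} [Monoid G] (e : FreeMonoid α →* G)
    (W : Language α) :
    (Submonoid.closure ((fun v : List α => e (FreeMonoid.ofList v)) '' W) : Set G) =
      (fun v : List α => e (FreeMonoid.ofList v)) '' (KStar.kstar W : Language α) := by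
  ext g
  constructor
  · intro hg
    induction hg using Submonoid.closure_induction with
    | mem g hg =>
      obtain ⟨v, hv, rfl⟩ := hg
      exact ⟨v, Language.mem_kstar.2 ⟨[v], by simp, fun y hy => List.mem_singleton.1 hy ▸ hv⟩, rfl⟩
    | one => exact ⟨[], Language.nil_mem_kstar W, by simp⟩
    | mul g h _ _ hg hh =>
      obtain ⟨v, hv, rfl⟩ := hg
      obtain ⟨w, hw, rfl⟩ := hh
      obtain ⟨L, rfl, hL⟩ := Language.mem_kstar.1 hv
      obtain ⟨K, rfl, hK⟩ := Language.mem_kstar.1 hw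
      refine ⟨(L ++ K).flatten, Language.mem_kstar.2 ⟨L ++ K, rfl, fun y hy => ?_⟩, by simp⟩
      rcases List.mem_append.1 hy with h | h
      exacts [hL y h, hK y h]
  · rintro ⟨v, hv, rfl⟩
    obtain ⟨L, rfl, hL⟩ := Language.mem_kstar.1 hv
    clear hv
    induction L with
    | nil => simp
    | cons w L ih =>
      simp only [List.flatten_cons, FreeMonoid.ofList_append, map_mul]
      exact mul_mem (Submonoid.subset_closure ⟨w, hL w (by simp), rfl⟩)
        (ih fun y hy => hL y (by simp [hy]))

end KleeneStar

section FiniteIndex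

/-- A word labelled by `h` leads from `p` to `q` in the given transducer. -/
def TransducerPath {A S M : Type*} [Monoid M] (step : S → A → S) (lab : S → A → M)
    (p : S) (h : M) (q : S) : Prop :=
  ∃ v : List A, v.foldl step p = q ∧ transduce step lab p v = h

theorem TransducerPath.trans {A M Q : Type*} [Monoid M] {step : Q → A → Q} {lab : Q → A → M}
    {p q r : Q} {h k : M}
    (h₁ : TransducerPath step lab p h q) (h₂ : TransducerPath step lab q k r) :
    TransducerPath step lab p (h * k) r := by
  obtain ⟨v, rfl, rfl⟩ := h₁
  obtain ⟨w, rfl, rfl⟩ := h₂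
  exact ⟨v ++ w, List.foldl_append, transduce_append _ _ _⟩

variable {A G N : Type*} [Group G] [Group N]

/-- The Reidemeister-Schreier rewriting of words into a subgroup of finite index, as a
transducer. -/
theorem exists_transducer_of_finiteIndex (e : FreeMonoid A →* G) {ψ : N →* G}
    (hψ : ψ.range.FiniteIndex) :
    ∃ (n : ℕ) (s₀ : Fin n) (step : Fin n → A → Fin n) (lab : Fin n → A → N) (r : Fin n → G),
      (∀ s w, ψ (transduce step lab s w) =
        (r s)⁻¹ * e (FreeMonoid.ofList w) * r (w.foldl step s)) ∧
      ∀ v w, e (FreeMonoid.ofList v) = e (FreeMonoid.ofList w) →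
        v.foldl step s₀ = w.foldl step s₀ := by
  have hfin : Finite (G ⧸ ψ.range) := inferInstance
  obtain ⟨n, ⟨c⟩⟩ := finite_iff_exists_equiv_fin.1 hfin
  let step : Fin n → A → Fin n := fun s a => c ((e (FreeMonoid.of a))⁻¹ • c.symm s)
  let r : Fin n → G := fun s => (c.symm s).out
  have hr : ∀ s, (QuotientGroup.mk (r s) : G ⧸ ψ.range) = c.symm s := fun s =>
    QuotientGroup.out_eq' _
  have hlab : ∀ s a, ∃ h : N, ψ h = (r s)⁻¹ * e (FreeMonoid.of a) * r (step s a) := by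
    intro s a
    have : (QuotientGroup.mk (r s) : G ⧸ ψ.range) =
        QuotientGroup.mk (e (FreeMonoid.of a) * r (step s a)) := by
      change _ = e (FreeMonoid.of a) • (QuotientGroup.mk (r (step s a)) : G ⧸ ψ.range)
      rw [hr, hr, Equiv.symm_apply_apply, smul_inv_smul]
    rw [QuotientGroup.eq] at this
    simpa [mul_assoc] using this
  choose lab hlab using hlab
  refine ⟨n, c (QuotientGroup.mk 1), step, lab, r, ?_, ?_⟩
  · intro s w
    induction w generalizing s with
    | nil => simp
    | cons a w ih =>
      rw [transduce_cons, map_mul, hlab, ih, FreeMonoid.ofList_cons, map_mul]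
      simp [mul_assoc]
  · have key : ∀ v s, v.foldl step s = c ((e (FreeMonoid.ofList v))⁻¹ • c.symm s) := by
      intro v
      induction v with
      | nil => simp
      | cons a v ih =>
        intro s
        rw [List.foldl_cons, ih, FreeMonoid.ofList_cons, map_mul, mul_inv_rev, mul_smul]
        simp [step]
    intro v w h
    rw [key, key, h]

theorem Language.IsRegular.exists_transducerPath_iff {e : FreeMonoid A →* G} {L : Language A}
    (hL : L.IsRegular) {ψ : N →* G} (hinj : Function.Injective ψ) (hψ : ψ.range.FiniteIndex) :
    ∃ (n : ℕ) (s₀ : Fin n) (step : Fin n → A → Fin n) (lab : Fin n → A → N)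
      (Q : Type) (_ : Finite Q) (stepQ : Q → A → Q) (labQ : Q → A → N) (q₀ : Q) (F : Set Q)
      (π : Q → Fin n), ∀ w : List A,
      e (FreeMonoid.ofList w) ∈ (fun v : List A => e (FreeMonoid.ofList v)) '' L ↔
        ∃ q ∈ F, w.foldl step s₀ = π q ∧
          TransducerPath stepQ labQ q₀ (transduce step lab s₀ w) q := by
  obtain ⟨n, s₀, step, lab, r, hout, hst⟩ := exists_transducer_of_finiteIndex e hψ
  obtain ⟨σ, _, M, rfl⟩ := hL
  let stepQ : σ × Fin n → A → σ × Fin n := fun q a => (M.step q.1 a, step q.2 a)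
  let labQ : σ × Fin n → A → N := fun q a => lab q.2 a
  have h₁ : ∀ v q, v.foldl stepQ q = (M.evalFrom q.1 v, v.foldl step q.2) := by
    intro v
    induction v with
    | nil => intro q; rfl
    | cons a v ih => intro q; rw [List.foldl_cons, ih]; rfl
  have h₂ : ∀ v q, transduce stepQ labQ q v = transduce step lab q.2 v := by
    intro v
    induction v with
    | nil => intro q; rfl
    | cons a v ih => intro q; rw [transduce_cons, ih, transduce_cons]
  refine ⟨n, s₀, step, lab, σ × Fin n, inferInstance, stepQ, labQ, (M.start, s₀),
    {q | q.1 ∈ M.accept}, Prod.snd, fun w => ?_⟩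
  constructor
  · rintro ⟨v, hv, hvw : e _ = e _⟩
    have hs := hst v w hvw
    refine ⟨(M.eval v, v.foldl step s₀), hv, hs.symm, v, h₁ _ _, ?_⟩
    apply hinj
    rw [h₂, hout, hout, hvw, hs]
  · rintro ⟨q, hq, hw, v, rfl, hv⟩
    rw [h₁] at hq hw
    refine ⟨v, hq, ?_⟩
    have := congrArg ψ hv
    rw [h₂, hout, hout, hw] at this
    simpa using this

end FiniteIndex

section PathEncoding

variable {G N : Type*} [Group G] [Group N]

theorem transducerPath_iff_mem_closure {A Q : Type*} {step : Q → A → Q} {lab : Q → A → N}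
    {φ : N →* N} {x : Q → N}
    (hx : ∀ P : Q → N → Q → Prop, (∀ p, P p 1 p) →
      (∀ p h q k r, P p h q → P q k r → P p (h * k) r) →
      ∀ p h q, transitionBlock φ x p h q ∈
        Submonoid.closure {t | ∃ p h q, P p h q ∧ transitionBlock φ x p h q = t} → P p h q)
    (p : Q) (h : N) (q : Q) :
    TransducerPath step lab p h q ↔ transitionBlock φ x p h q ∈ Submonoid.closure
      (Set.range fun c : Q × A => transitionBlock φ x c.1 (lab c.1 c.2) (step c.1 c.2)) := by
  constructor
  · rintro ⟨v, rfl, rfl⟩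
    induction v generalizing p with
    | nil => simp [transitionBlock_self_one]
    | cons a v ih =>
      rw [transduce_cons, List.foldl_cons, ← transitionBlock_mul φ x p (step p a)]
      exact mul_mem (Submonoid.subset_closure ⟨(p, a), rfl⟩) (ih _)
  · intro hm
    refine hx (TransducerPath step lab) (fun p => ⟨[], rfl, rfl⟩)
      (fun _ _ _ _ _ => TransducerPath.trans) p h q (Submonoid.closure_mono ?_ hm)
    rintro _ ⟨⟨p, a⟩, rfl⟩
    exact ⟨p, lab p a, step p a, ⟨[a], rfl, by simp⟩, rfl⟩

theorem HasPathEncoding.computablePred_mem_image {Δ : Type} [Fintype Δ] [Primcodable Δ]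
    (hN : HasPathEncoding N) {ψ : N →* G} (hinj : Function.Injective ψ)
    (hψ : ψ.range.FiniteIndex) {e : FreeMonoid Δ →* G} (he : Function.Surjective e)
    (hsub : ∀ W : Set (List Δ), W.Finite → ComputablePred fun w : List Δ =>
      e (FreeMonoid.ofList w) ∈
        Submonoid.closure ((fun v : List Δ => e (FreeMonoid.ofList v)) '' W))
    {L : Language Δ} (hL : L.IsRegular) :
    ComputablePred fun w : List Δ =>
      e (FreeMonoid.ofList w) ∈ (fun v : List Δ => e (FreeMonoid.ofList v)) '' L := by
  obtain ⟨n, s₀, step, lab, Q, _, stepQ, labQ, q₀, F, π, hiff⟩ :=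
    hL.exists_transducerPath_iff (e := e) hinj hψ
  obtain ⟨φ, x', hx'⟩ := hN
  obtain ⟨m, ⟨c⟩⟩ := finite_iff_exists_equiv_fin.1 ‹Finite Q›
  let x : Q → N := x' ∘ fun q => (c q : ℕ)
  have hx := hx' Q (fun q => (c q : ℕ)) (Fin.val_injective.comp c.injective)
  choose wd hwd using he
  let gen : Q × Δ → List Δ := fun d =>
    FreeMonoid.toList (wd (ψ (transitionBlock φ x d.1 (labQ d.1 d.2) (stepQ d.1 d.2))))
  let : Primcodable (FreeMonoid Δ) := (inferInstance : Primcodable (List Δ))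
  let out : List Δ → FreeMonoid Δ :=
    transduce step (fun s a => wd (ψ (φ (lab s a)))) s₀
  have hmul : Primrec₂ fun v w : FreeMonoid Δ => v * w := Primrec.list_append (α := Δ)
  have hout : Primrec out := primrec_transduce hmul s₀
  have hgen : Submonoid.closure ((fun v : List Δ => e (FreeMonoid.ofList v)) '' Set.range gen) =
      (Submonoid.closure (Set.range fun c : Q × Δ =>
        transitionBlock φ x c.1 (labQ c.1 c.2) (stepQ c.1 c.2))).map ψ := by
    rw [MonoidHom.map_mclosure, ← Set.range_comp, ← Set.range_comp]
    congr 2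
    ext d
    simp [gen, hwd]
  have hred : ∀ q, ComputablePred fun w : List Δ =>
      TransducerPath stepQ labQ q₀ (transduce step lab s₀ w) q := by
    intro q
    have hf : Primrec fun w : List Δ =>
        wd (ψ (x q₀)) * out w * wd (ψ (x q)⁻¹) :=
      hmul.comp (hmul.comp (Primrec.const _) hout) (Primrec.const _)
    refine ((hsub (Set.range gen) (Set.finite_range _)).preimage
      (f := fun w => wd (ψ (x q₀)) * out w * wd (ψ (x q)⁻¹)) hf.to_comp).of_eq fun w => ?_
    rw [transducerPath_iff_mem_closure hx, hgen, ← Submonoid.mem_map_iff_mem hinj]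
    have : e (out w) = ψ (φ (transduce step lab s₀ w)) := by
      simp only [out, map_transduce, hwd]
    change e (wd (ψ (x q₀)) * out w * wd (ψ (x q)⁻¹)) ∈ _ ↔ _
    rw [map_mul, map_mul, hwd, hwd, this, ← map_mul, ← map_mul]
    rfl
  have hst : ∀ q, ComputablePred fun w : List Δ => w.foldl step s₀ = π q := fun q =>
    (ComputablePred.of_finite (· = π q)).preimage (primrec_foldl_step s₀).to_comp
  refine (ComputablePred.exists_finite fun q =>
    (ComputablePred.const_prop (q ∈ F)).conj ((hst q).conj (hred q))).of_eq fun w => ?_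
  exact (hiff w).symm

end PathEncoding

section Integers

theorem computablePred_of_eventually_add {T : ℕ → Prop} {N d : ℕ} (hd : 0 < d)
    (hT : ∀ n, N ≤ n → T n → T (n + d)) : ComputablePred T := by
  classical
  have hmod : Primrec fun n : ℕ => n % d := Primrec.nat_mod.comp Primrec.id (Primrec.const d)
  have hlarge : ∀ r : Fin d, ComputablePred fun n : ℕ => n % d = r ∧ N ≤ n ∧ T n := by
    intro r
    by_cases hne : ∃ m, m % d = r ∧ N ≤ m ∧ T m
    · obtain ⟨hm₁, hm₂, hm₃⟩ := Nat.find_spec hne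
      have h₁ : PrimrecPred fun n => n % d = r := Primrec.eq.comp hmod (Primrec.const (r : ℕ))
      have h₂ : PrimrecPred fun n => Nat.find hne ≤ n :=
        Primrec.nat_le.comp (Primrec.const _) Primrec.id
      refine (h₁.computablePred.conj h₂.computablePred).of_eq fun n => ⟨fun ⟨hn, hle⟩ => ?_,
        fun h => ⟨h.1, Nat.find_min' hne h⟩⟩
      obtain ⟨k, hk⟩ : d ∣ n - Nat.find hne :=
        (Nat.modEq_iff_dvd' hle).1 (hm₁.trans hn.symm)
      obtain rfl : n = Nat.find hne + d * k := by omega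
      suffices ∀ k, T (Nat.find hne + d * k) from ⟨hn, hm₂.trans hle, this k⟩
      intro k
      induction k with
      | zero => simpa using hm₃
      | succ k ih =>
        rw [mul_add_one, ← add_assoc]
        exact hT _ (by omega) ih
    · exact (ComputablePred.const_prop False).of_eq fun n => by
        simpa using fun h₁ h₂ h₃ => hne ⟨n, h₁, h₂, h₃⟩
  have hsmall : ∀ k : Fin N, ComputablePred fun n : ℕ => n = k ∧ T n := by
    intro k
    have h : PrimrecPred fun n : ℕ => n = k := Primrec.eq.comp Primrec.id (Primrec.const (k : ℕ))
    exact (h.computablePred.conj (ComputablePred.const_prop (T k))).of_eq fun n =>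
      and_congr_right fun h => by rw [h]
  refine ((ComputablePred.exists_finite hsmall).disj
    (ComputablePred.exists_finite (ι := Fin d) hlarge)).of_eq fun n => ⟨?_, fun hn => ?_⟩
  · rintro (⟨k, -, h⟩ | ⟨r, -, -, h⟩) <;> exact h
  · rcases lt_or_ge n N with h | h
    · exact Or.inl ⟨⟨n, h⟩, rfl, hn⟩
    · exact Or.inr ⟨⟨n % d, Nat.mod_lt n hd⟩, rfl, h, hn⟩

variable {A Q : Type*} {step : Q → A → Q} {lab : Q → A → Multiplicative ℤ}

theorem toAdd_transduce_le {B : ℤ} (hB : ∀ q a, (lab q a).toAdd ≤ B) (p : Q) (v : List A) :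
    (transduce step lab p v).toAdd ≤ B * v.length := by
  induction v generalizing p with
  | nil => simp
  | cons a v ih =>
    rw [transduce_cons, toAdd_mul, List.length_cons]
    push_cast
    linarith [hB p a, ih (step p a)]

/-- A path of large weight visits a state with a short loop of positive weight. -/
theorem exists_loop_of_lt_toAdd_transduce [Fintype Q] {B : ℤ} (hB₀ : 0 ≤ B)
    (hB : ∀ q a, (lab q a).toAdd ≤ B) (p : Q) (v : List A)
    (hv : B * Fintype.card Q < (transduce step lab p v).toAdd) :
    ∃ v₁ v₂ u, v = v₁ ++ v₂ ∧ u.foldl step (v₁.foldl step p) = v₁.foldl step p ∧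
      0 < (transduce step lab (v₁.foldl step p) u).toAdd ∧
      (transduce step lab (v₁.foldl step p) u).toAdd ≤ B * Fintype.card Q := by
  induction hn : v.length using Nat.strong_induction_on generalizing v with
  | _ n ih =>
    have hlen : Fintype.card Q ≤ v.length := by
      by_contra hlt
      have h₁ := toAdd_transduce_le (step := step) hB p v
      have h₂ : (v.length : ℤ) ≤ Fintype.card Q := by omega
      nlinarith
    let M : DFA A Q := ⟨step, p, ∅⟩
    obtain ⟨q, a, b, c, rfl, hab, hb, ha, hbq, -⟩ :=
      M.evalFrom_split (s := p) hlen rfl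
    change a.foldl step p = q at ha
    change b.foldl step q = q at hbq
    subst ha
    by_cases hpos : 0 < (transduce step lab (a.foldl step p) b).toAdd
    · refine ⟨a, b ++ c, b, by simp, hbq, hpos, (toAdd_transduce_le hB _ _).trans ?_⟩
      gcongr
      omega
    · have hb' : 0 < b.length := List.length_pos_iff.2 hb
      obtain ⟨v₁, v₂, u, h, hu⟩ := ih (a ++ c).length (by simp at hn ⊢; omega) (a ++ c) (by
        rw [List.append_assoc, transduce_append, transduce_append, hbq] at hv
        rw [transduce_append]
        simp only [toAdd_mul] at hv ⊢
        linarith) rfl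
      rcases List.append_eq_append_iff.1 h with ⟨t, rfl, rfl⟩ | ⟨t, rfl, rfl⟩
      · refine ⟨a ++ b ++ t, v₂, u, by simp, ?_⟩
        have : (a ++ b ++ t).foldl step p = (a ++ t).foldl step p := by
          simp only [List.foldl_append, hbq]
        rwa [this]
      · exact ⟨v₁, t ++ b ++ c, u, by simp, hu⟩

theorem TransducerPath.pow {M : Type*} [Monoid M] {lab : Q → A → M} {p : Q} {h : M}
    (hp : TransducerPath step lab p h p) (n : ℕ) : TransducerPath step lab p (h ^ n) p := by
  induction n with
  | zero => exact ⟨[], rfl, by simp⟩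
  | succ n ih => exact pow_succ h n ▸ ih.trans hp

theorem TransducerPath.exists_period [Finite Q] [Finite A] (step : Q → A → Q)
    (lab : Q → A → Multiplicative ℤ) :
    ∃ N d : ℕ, 0 < d ∧ ∀ p q (n : ℕ), N ≤ n →
      TransducerPath step lab p (.ofAdd (n : ℤ)) q →
      TransducerPath step lab p (.ofAdd ((n + d : ℕ) : ℤ)) q := by
  have := Fintype.ofFinite Q
  obtain ⟨B, hB⟩ : ∃ B : ℕ, ∀ q a, (lab q a).toAdd ≤ B := by
    obtain ⟨b, hb⟩ := (Set.finite_range fun c : Q × A => (lab c.1 c.2).toAdd).bddAbove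
    exact ⟨b.toNat, fun q a => (hb ⟨(q, a), rfl⟩).trans (Int.self_le_toNat b)⟩
  refine ⟨B * Fintype.card Q + 1, (B * Fintype.card Q).factorial, Nat.factorial_pos _, ?_⟩
  rintro p _ n hn ⟨v, rfl, hv⟩
  obtain ⟨v₁, v₂, u, rfl, hu, hpos, hle⟩ := exists_loop_of_lt_toAdd_transduce
    (Int.natCast_nonneg B) hB p v (by rw [hv, toAdd_ofAdd]; exact_mod_cast hn)
  obtain ⟨c, hc⟩ := Int.eq_ofNat_of_zero_le hpos.le
  rw [hc] at hpos hle
  obtain ⟨k, hk⟩ := Nat.dvd_factorial (m := c) (n := B * Fintype.card Q)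
    (by exact_mod_cast hpos) (by exact_mod_cast hle)
  have h₁ : TransducerPath step lab p (transduce step lab p v₁) (v₁.foldl step p) := ⟨v₁, rfl, rfl⟩
  have h₂ : TransducerPath step lab (v₁.foldl step p) (.ofAdd (c : ℤ)) (v₁.foldl step p) :=
    ⟨u, hu, by rw [← hc, ofAdd_toAdd]⟩
  have h₃ : TransducerPath step lab (v₁.foldl step p)
      (transduce step lab (v₁.foldl step p) v₂) ((v₁ ++ v₂).foldl step p) :=
    ⟨v₂, List.foldl_append.symm, rfl⟩
  convert (h₁.trans (h₂.pow k)).trans h₃ using 1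
  rw [mul_right_comm, ← transduce_append, hv, ← ofAdd_nsmul, ← ofAdd_add, hk]
  congr 1
  push_cast
  simp [mul_comm]

theorem transducerPath_inv {M : Type*} [CommGroup M] {lab : Q → A → M} {p q : Q} {h : M} :
    TransducerPath step (fun s a => (lab s a)⁻¹) p h q ↔ TransducerPath step lab p h⁻¹ q := by
  have : ∀ v, transduce step (fun s a => (lab s a)⁻¹) p v = (transduce step lab p v)⁻¹ :=
    fun v => (map_transduce (invMonoidHom : M →* M) p v).symm
  simp only [TransducerPath, this, inv_eq_iff_eq_inv]

theorem computablePred_transducerPath_sub [Finite Q] [Finite A] (step : Q → A → Q)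
    (lab : Q → A → Multiplicative ℤ) (p q : Q) :
    ComputablePred fun c : ℕ × ℕ => TransducerPath step lab p (.ofAdd (c.1 - c.2 : ℤ)) q := by
  have key : ∀ lab : Q → A → Multiplicative ℤ,
      ComputablePred fun n : ℕ => TransducerPath step lab p (.ofAdd (n : ℤ)) q := by
    intro lab
    obtain ⟨N, d, hd, h⟩ := TransducerPath.exists_period step lab
    exact computablePred_of_eventually_add hd fun n => h p q n
  have h₁ : PrimrecPred fun c : ℕ × ℕ => c.2 ≤ c.1 := Primrec.nat_le.comp Primrec.snd Primrec.fst
  have h₂ : PrimrecPred fun c : ℕ × ℕ => c.1 ≤ c.2 := Primrec.nat_le.comp Primrec.fst Primrec.snd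
  have h₃ : Primrec fun c : ℕ × ℕ => c.1 - c.2 := Primrec.nat_sub.comp Primrec.fst Primrec.snd
  have h₄ : Primrec fun c : ℕ × ℕ => c.2 - c.1 := Primrec.nat_sub.comp Primrec.snd Primrec.fst
  refine ((h₁.computablePred.conj ((key lab).preimage h₃.to_comp)).disj
    (h₂.computablePred.conj ((key fun s a => (lab s a)⁻¹).preimage h₄.to_comp))).of_eq ?_
  rintro ⟨a, b⟩
  simp only [transducerPath_inv, ← ofAdd_neg]
  constructor
  · rintro (⟨h, h'⟩ | ⟨h, h'⟩)
    · rwa [Nat.cast_sub h] at h'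
    · rwa [Nat.cast_sub h, neg_sub] at h'
  · intro h'
    rcases le_total b a with h | h
    · exact Or.inl ⟨h, by rwa [Nat.cast_sub h]⟩
    · exact Or.inr ⟨h, by rwa [Nat.cast_sub h, neg_sub]⟩

theorem Language.IsRegular.computablePred_mem_image_of_int {G : Type*} [Group G]
    {Δ : Type} [Finite Δ] [Primcodable Δ] {ψ : Multiplicative ℤ →* G}
    (hinj : Function.Injective ψ) (hψ : ψ.range.FiniteIndex) (e : FreeMonoid Δ →* G)
    {L : Language Δ} (hL : L.IsRegular) :
    ComputablePred fun w : List Δ =>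
      e (FreeMonoid.ofList w) ∈ (fun v : List Δ => e (FreeMonoid.ofList v)) '' L := by
  obtain ⟨n, s₀, step, lab, Q, _, stepQ, labQ, q₀, F, π, hiff⟩ :=
    hL.exists_transducerPath_iff (e := e) hinj hψ
  let : Primcodable (Multiplicative ℕ) := (inferInstance : Primcodable ℕ)
  have hmul : Primrec₂ fun x y : Multiplicative ℕ => x * y := Primrec.nat_add
  let pos : List Δ → Multiplicative ℕ :=
    transduce step (fun s a => .ofAdd (lab s a).toAdd.toNat) s₀
  let neg : List Δ → Multiplicative ℕ :=
    transduce step (fun s a => .ofAdd (-(lab s a).toAdd).toNat) s₀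
  have hpos : Primrec pos := primrec_transduce hmul s₀
  have hneg : Primrec neg := primrec_transduce hmul s₀
  let out : List Δ → ℕ × ℕ := fun w => ((pos w).toAdd, (neg w).toAdd)
  have hout : Primrec out := Primrec.pair hpos hneg
  have hval : ∀ w, transduce step lab s₀ w = .ofAdd ((out w).1 - (out w).2 : ℤ) := by
    have h : ∀ (w : List Δ) s, (transduce step lab s w).toAdd =
        ((transduce step (fun s a => Multiplicative.ofAdd (lab s a).toAdd.toNat) s w).toAdd : ℤ) -
        (transduce step (fun s a => Multiplicative.ofAdd (-(lab s a).toAdd).toNat) s w).toAdd := by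
      intro w
      induction w with
      | nil => simp
      | cons a w ih =>
        intro s
        simp only [transduce_cons, toAdd_mul, ih, toAdd_ofAdd]
        push_cast
        omega
    intro w
    rw [← ofAdd_toAdd (transduce step lab s₀ w), h]
  have hst : ∀ q, ComputablePred fun w : List Δ => w.foldl step s₀ = π q := fun q =>
    (ComputablePred.of_finite (· = π q)).preimage (primrec_foldl_step s₀).to_comp
  refine (ComputablePred.exists_finite fun q => (ComputablePred.const_prop (q ∈ F)).conj
    ((hst q).conj ((computablePred_transducerPath_sub stepQ labQ q₀ q).preimage
      hout.to_comp))).of_eq fun w => ?_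
  rw [hiff, hval]

end Integers

section InfiniteDihedral

open Monoid

variable {G₁ G₂ : Type*} [Group G₁] [Group G₂]

/-- A group with at most one nontrivial element maps to any involution. -/
theorem exists_monoidHom_of_forall_eq {D : Type*} [Group D] {a : G₁} (ha : a ≠ 1)
    (h : ∀ g : G₁, g = 1 ∨ g = a) {d : D} (hd : d * d = 1) : ∃ f : G₁ →* D, f a = d := by
  classical
  have haa : a * a = 1 := (h (a * a)).resolve_right (by simpa using ha)
  refine ⟨{ toFun := fun g => if g = 1 then 1 else d, map_one' := by simp, map_mul' := ?_ },
    if_neg ha⟩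
  intro x y
  rcases h x with rfl | rfl <;> rcases h y with rfl | rfl <;> simp [ha, haa, hd]

theorem Monoid.Coprod.exists_int_embedding_of_forall_eq {a : G₁} {b : G₂} (ha : a ≠ 1) (hb : b ≠ 1)
    (h₁ : ∀ g : G₁, g = 1 ∨ g = a) (h₂ : ∀ g : G₂, g = 1 ∨ g = b) :
    ∃ ψ : Multiplicative ℤ →* Coprod G₁ G₂, Function.Injective ψ ∧ ψ.range.FiniteIndex := by
  have haa : (Coprod.inl a : Coprod G₁ G₂) * Coprod.inl a = 1 := by
    rw [← map_mul, (h₁ (a * a)).resolve_right (by simpa using ha), map_one]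
  have hbb : (Coprod.inr b : Coprod G₁ G₂) * Coprod.inr b = 1 := by
    rw [← map_mul, (h₂ (b * b)).resolve_right (by simpa using hb), map_one]
  set t : Coprod G₁ G₂ := Coprod.inl a * Coprod.inr b with ht
  refine ⟨zpowersHom _ t, ?_, ?_⟩
  · obtain ⟨f₁, hf₁⟩ := exists_monoidHom_of_forall_eq (D := DihedralGroup 0) ha h₁
      (DihedralGroup.sr_mul_self 0)
    obtain ⟨f₂, hf₂⟩ := exists_monoidHom_of_forall_eq (D := DihedralGroup 0) hb h₂
      (DihedralGroup.sr_mul_self 1)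
    have hft : Coprod.lift f₁ f₂ t = DihedralGroup.r 1 := by
      rw [ht, map_mul, Coprod.lift_apply_inl, Coprod.lift_apply_inr, hf₁, hf₂]
      simp
    have ht' : ¬ IsOfFinOrder t := fun h => by
      have := (Coprod.lift f₁ f₂).isOfFinOrder h
      rw [hft, ← orderOf_pos_iff, DihedralGroup.orderOf_r_one] at this
      exact this.false
    exact fun m n hmn => Multiplicative.toAdd.injective
      (injective_zpow_iff_not_isOfFinOrder.2 ht' hmn)
  · have hrange : (zpowersHom _ t).range = Subgroup.zpowers t := by
      ext x
      simp [Subgroup.mem_zpowers_iff, MonoidHom.mem_range, zpowersHom_apply]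
    rw [hrange]
    have ht_mem := Subgroup.mem_zpowers t
    have hainv : (Coprod.inl a : Coprod G₁ G₂)⁻¹ = Coprod.inl a := inv_eq_of_mul_eq_one_left haa
    have hbinv : (Coprod.inr b : Coprod G₁ G₂)⁻¹ = Coprod.inr b := inv_eq_of_mul_eq_one_left hbb
    have hconj : ∀ k ∈ Subgroup.zpowers t,
        Coprod.inl a * k * Coprod.inl a ∈ Subgroup.zpowers t := by
      rintro _ ⟨n, rfl⟩
      have : Coprod.inl a * t * (Coprod.inl a)⁻¹ = t⁻¹ := by
        rw [ht, mul_inv_rev, hainv, hbinv, ← mul_assoc, haa, one_mul]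
      have h := conj_zpow (a := Coprod.inl a) (b := t) (i := n)
      rw [this, hainv] at h
      exact h ▸ zpow_mem (inv_mem ht_mem) n
    have hinl : ∀ h : Coprod G₁ G₂,
        (h ∈ Subgroup.zpowers t ∨ h * Coprod.inl a ∈ Subgroup.zpowers t) →
        Coprod.inl a * h ∈ Subgroup.zpowers t ∨
          Coprod.inl a * h * Coprod.inl a ∈ Subgroup.zpowers t := by
      rintro h (hh | hh)
      · exact Or.inr (hconj h hh)
      · left
        simpa [mul_assoc, haa] using hconj _ hh
    have hmem : ∀ h : Coprod G₁ G₂,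
        h ∈ Subgroup.zpowers t ∨ h * Coprod.inl a ∈ Subgroup.zpowers t := by
      intro h
      induction h using Coprod.induction_on' with
      | one => exact Or.inl (one_mem _)
      | inl_mul g h ih =>
        rcases h₁ g with rfl | rfl
        · simpa using ih
        · exact hinl h ih
      | inr_mul g h ih =>
        rcases h₂ g with rfl | rfl
        · simpa using ih
        · have : Coprod.inr g * h = Coprod.inl a * (t * h) := by
            rw [ht, mul_assoc, ← mul_assoc _ _ (Coprod.inr g * h), haa, one_mul]
          rw [this]
          refine hinl _ (ih.imp (mul_mem ht_mem) fun h' => ?_)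
          rw [mul_assoc]
          exact mul_mem ht_mem h'
    have hfin : Finite (Coprod G₁ G₂ ⧸ Subgroup.zpowers t) := by
      refine Finite.of_surjective (fun i : Bool => (QuotientGroup.mk
        (bif i then 1 else Coprod.inl a) : Coprod G₁ G₂ ⧸ Subgroup.zpowers t)) fun c => ?_
      obtain ⟨h, rfl⟩ := QuotientGroup.mk_surjective c
      rcases hmem h⁻¹ with hh | hh
      · exact ⟨true, QuotientGroup.eq.2 (by simpa using hh)⟩
      · exact ⟨false, (QuotientGroup.eq.2 hh).symm⟩
    exact Subgroup.finiteIndex_of_finite_quotient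

end InfiniteDihedral

theorem MonoidHom.finiteIndex_range_comp {M N G : Type*} [Group M] [Group N] [Group G]
    {ψ : N →* G} (hψ : ψ.range.FiniteIndex) {χ : M →* N} (hχ : χ.range.FiniteIndex) :
    (ψ.comp χ).range.FiniteIndex := by
  refine ⟨?_⟩
  rw [MonoidHom.range_comp, Subgroup.index_map]
  refine mul_ne_zero ?_ hψ.index_ne_zero
  have := Subgroup.finiteIndex_of_le (le_sup_left : χ.range ≤ χ.range ⊔ ψ.ker)
  exact this.index_ne_zero

/-- For a finitely generated group `G` that is virtually a (nontrivial) free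
product, the submonoid membership problem and the rational subset membership
problem are recursively equivalent. -/
theorem virtuallyFreeProduct_submonoidMembership_iff_rationalSubsetMembership
    {G : Type u} [Group G] (hGfg : Group.FG G)
    (hvfp : ∃ H : Subgroup G, H.FiniteIndex ∧
      ∃ (G₁ G₂ : Type u) (_ : Group G₁) (_ : Group G₂),
        (∃ x : G₁, x ≠ 1) ∧ (∃ y : G₂, y ≠ 1) ∧
        Nonempty (H ≃* Monoid.Coprod G₁ G₂))
    {Δ : Type} [Fintype Δ] [DecidableEq Δ]
    (e : FreeMonoid Δ →* G) (he : Function.Surjective e) :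
    (∀ W : Set (List Δ), W.Finite →
      ComputablePred (fun w : List Δ =>
        e (FreeMonoid.ofList w) ∈
          Submonoid.closure ((fun v : List Δ => e (FreeMonoid.ofList v)) '' W)))
    ↔ (∀ L : Language Δ, L.IsRegular →
      ComputablePred (fun w : List Δ =>
        e (FreeMonoid.ofList w) ∈ (fun v : List Δ => e (FreeMonoid.ofList v)) '' L)) := by
  refine ⟨fun hsub L hL => ?_, fun hrat W hW => ?_⟩
  · obtain ⟨H, hH, G₁, G₂, _, _, ⟨a, ha⟩, ⟨b, hb⟩, ⟨f⟩⟩ := hvfp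
    let ψ : Monoid.Coprod G₁ G₂ →* G := H.subtype.comp f.symm.toMonoidHom
    have hinj : Function.Injective ψ := H.subtype_injective.comp f.symm.injective
    have hψ : ψ.range.FiniteIndex := by
      rw [MonoidHom.range_comp, MonoidHom.range_eq_top.2 f.symm.surjective,
        ← MonoidHom.range_eq_map, Subgroup.range_subtype]
      exact hH
    by_cases h₂ : ∀ g : G₂, g = 1 ∨ g = b
    · by_cases h₁ : ∀ g : G₁, g = 1 ∨ g = a
      · obtain ⟨χ, hχ, hχ'⟩ := Monoid.Coprod.exists_int_embedding_of_forall_eq ha hb h₁ h₂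
        exact hL.computablePred_mem_image_of_int (ψ := ψ.comp χ) (hinj.comp hχ)
          (MonoidHom.finiteIndex_range_comp hψ hχ') e
      · push Not at h₁
        obtain ⟨c, hc, hca⟩ := h₁
        have hN := (Monoid.Coprod.hasPathEncoding ⟨b, hb⟩ ha hc hca.symm).of_mulEquiv
          (MulEquiv.coprodComm G₂ G₁)
        exact hN.computablePred_mem_image hinj hψ he hsub hL
    · push Not at h₂
      obtain ⟨c, hc, hcb⟩ := h₂
      exact (Monoid.Coprod.hasPathEncoding ⟨a, ha⟩ hb hc hcb.symm).computablePred_mem_image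
        hinj hψ he hsub hL
  · exact (hrat _ (Language.kstar_isRegular_of_finite hW)).of_eq fun w =>
      (Set.ext_iff.1 (Submonoid.closure_image_ofList e W) (e (FreeMonoid.ofList w))).symm
end

section
/- Let G be a finitely generated group acting on a type V (MulAction), let T : SimpleGraph V be a tree (T.IsTree), and suppose the action is by graph automorphisms (for all g ∈ G and u v ∈ V, T.Adj u v implies T.Adj (g • u) (g • v)) and without inversions (there are no g ∈ G and adjacent u, v ∈ V with g • u = v and g • v = u). Suppose the action of G is nontrivial, i.e. there is no vertex v ∈ V with g • v = v for all g ∈ G. Then for every finite-index subgroup H of G, the action of H on T is also nontrivial: there is no vertex v ∈ V with h • v = v for all h ∈ H. -/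
namespace SimpleGraph

variable {V : Type*} {T : SimpleGraph V}

/-- In a tree, a vertex has at most one neighbour that is closer to a given vertex. -/
theorem IsTree.eq_of_adj_of_dist_eq_dist_add_one (hT : T.IsTree) {s x y z : V}
    (hy : T.Adj x y) (hz : T.Adj x z) (hdy : T.dist x s = T.dist y s + 1)
    (hdz : T.dist x s = T.dist z s + 1) : y = z := by
  obtain ⟨p, hp⟩ := hT.connected.exists_walk_length_eq_dist y s
  obtain ⟨q, hq⟩ := hT.connected.exists_walk_length_eq_dist z s
  have hp' : (Walk.cons hy p).IsPath :=
    Walk.isPath_of_length_eq_dist _ (by rw [Walk.length_cons, hp, hdy])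
  have hq' : (Walk.cons hz q).IsPath :=
    Walk.isPath_of_length_eq_dist _ (by rw [Walk.length_cons, hq, hdz])
  have h := (hT.isAcyclic.subsingleton_path x s).elim ⟨_, hp'⟩ ⟨_, hq'⟩
  simpa using congrArg (fun r : T.Path x s => r.1.snd) h

/-- In a tree, once a path moves away from a vertex, it keeps moving away from it. -/
theorem IsTree.dist_eq_dist_add_length_of_isPath_cons (hT : T.IsTree) (s : V) {x u w : V}
    (p : T.Walk u w) (h : T.Adj x u) (hp : (Walk.cons h p).IsPath)
    (hd : T.dist u s = T.dist x s + 1) : T.dist w s = T.dist u s + p.length := by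
  induction p generalizing x with
  | nil => simp
  | @cons u y w h' p ih =>
    have hxy : x ≠ y := by
      rintro rfl
      simp [Walk.cons_isPath_iff] at hp
    have hd' : T.dist y s = T.dist u s + 1 := by
      rcases hT.dist_eq_dist_add_one_of_adj s h' with hc | hc
      · rw [dist_comm, dist_comm (u := s)] at hc
        exact absurd (hT.eq_of_adj_of_dist_eq_dist_add_one h.symm h' hd hc) hxy
      · rwa [dist_comm, dist_comm (u := s)] at hc
    rw [ih h' hp.of_cons hd', hd', Walk.length_cons]
    ring

/-- Two distinct non-adjacent vertices of a tree admit a vertex that is, for each vertex `s`,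
strictly closer to `s` than one of the two. -/
theorem IsTree.exists_forall_dist_lt_or_dist_lt (hT : T.IsTree) {u w : V} (hne : u ≠ w)
    (hadj : ¬ T.Adj u w) :
    ∃ x, ∀ s, T.dist x s < T.dist u s ∨ T.dist x s < T.dist w s := by
  obtain ⟨p, hp, -⟩ := hT.existsUnique_path u w
  cases p with
  | nil => exact absurd rfl hne
  | @cons _ x _ h p =>
    refine ⟨x, fun s => ?_⟩
    have hlen : p.length ≠ 0 := fun h0 => hadj (Walk.eq_of_length_eq_zero h0 ▸ h)
    rcases hT.dist_eq_dist_add_one_of_adj s h with hc | hc <;>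
      rw [dist_comm, dist_comm (u := s)] at hc
    · left; omega
    · right
      have := hT.dist_eq_dist_add_length_of_isPath_cons s p h hp hc
      omega

/-- Automorphisms of a graph coming from a group action preserve distances. -/
theorem dist_smul_smul {G : Type*} [Group G] [MulAction G V]
    (hauto : ∀ (g : G) (u v : V), T.Adj u v → T.Adj (g • u) (g • v)) (hT : T.Connected)
    (g : G) (u v : V) : T.dist (g • u) (g • v) = T.dist u v := by
  have key : ∀ (g : G) (u v : V), T.dist (g • u) (g • v) ≤ T.dist u v := by
    intro g u v
    obtain ⟨p, hp⟩ := hT.exists_walk_length_eq_dist u v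
    let f : T →g T := ⟨fun x => g • x, fun h => hauto g _ _ h⟩
    rw [← hp, ← p.length_map f]
    exact dist_le (p.map f)
  refine le_antisymm (key g u v) ?_
  simpa using key g⁻¹ (g • u) (g • v)

/-- A group acting on a tree without inversions and with a finite orbit fixes a vertex. -/
theorem IsTree.exists_forall_smul_eq_of_finite_orbit {G : Type*} [Group G] [MulAction G V]
    (hT : T.IsTree) (hauto : ∀ (g : G) (u v : V), T.Adj u v → T.Adj (g • u) (g • v))
    (hnoinv : ¬ ∃ (g : G) (u v : V), T.Adj u v ∧ g • u = v ∧ g • v = u)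
    {v : V} (hfin : (MulAction.orbit G v).Finite) : ∃ u : V, ∀ g : G, g • u = u := by
  classical
  let P : ℕ → V → Prop := fun m u => ∀ s ∈ MulAction.orbit G v, T.dist u s ≤ m
  have hex : ∃ m u, P m u := by
    obtain ⟨m, hm⟩ := (hfin.image fun s => T.dist v s).bddAbove
    exact ⟨m, v, fun s hs => hm ⟨s, hs, rfl⟩⟩
  have hinv : ∀ (m : ℕ) (g : G) (u : V), P m u → P m (g • u) := by
    intro m g u hu s hs
    have := hu (g⁻¹ • s) (MulAction.mapsTo_smul_orbit g⁻¹ v hs)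
    rwa [← dist_smul_smul hauto hT.connected g, smul_inv_smul] at this
  have hadj : ∀ u w, P (Nat.find hex) u → P (Nat.find hex) w → u ≠ w → T.Adj u w := by
    intro u w hu hw hne
    by_contra hna
    obtain ⟨x, hx⟩ := hT.exists_forall_dist_lt_or_dist_lt hne hna
    have hlt : ∀ s ∈ MulAction.orbit G v, T.dist x s < Nat.find hex := fun s hs =>
      (hx s).elim (fun h => h.trans_le (hu s hs)) fun h => h.trans_le (hw s hs)
    have hpos := hlt v (MulAction.mem_orbit_self v)
    exact Nat.find_min hex (m := Nat.find hex - 1) (by omega)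
      ⟨x, fun s hs => Nat.le_sub_one_of_lt (hlt s hs)⟩
  obtain ⟨u, hu⟩ := Nat.find_spec hex
  refine ⟨u, fun g => ?_⟩
  by_contra hgu
  have hu₁ := hinv _ g u hu
  have hu₂ := hinv _ g _ hu₁
  have h₁ := hadj u (g • u) hu hu₁ (Ne.symm hgu)
  have h₂ := hauto g _ _ h₁
  refine hnoinv ⟨g, u, g • u, h₁, rfl, ?_⟩
  by_contra h
  have h₃ := hadj u (g • g • u) hu hu₂ (Ne.symm h)
  exact hT.isAcyclic.cliqueFree le_rfl {u, g • u, g • g • u}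
    (is3Clique_triple_iff.2 ⟨h₁, h₃, h₂⟩)

end SimpleGraph


/-- If a finitely generated group `G` acts nontrivially (without a global fixed
vertex) on a tree by graph automorphisms and without inversions, then every
finite-index subgroup of `G` also acts nontrivially. -/
theorem finiteIndex_subgroup_acts_nontrivially_on_tree
    {G V : Type*} [Group G] (hGfg : Group.FG G) [MulAction G V]
    (T : SimpleGraph V) (hT : T.IsTree)
    (hauto : ∀ (g : G) (u v : V), T.Adj u v → T.Adj (g • u) (g • v))
    (hnoinv : ¬ ∃ (g : G) (u v : V), T.Adj u v ∧ g • u = v ∧ g • v = u)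
    (hnontriv : ¬ ∃ v : V, ∀ g : G, g • v = v)
    (H : Subgroup G) (hfi : H.FiniteIndex) :
    ¬ ∃ v : V, ∀ h ∈ H, h • v = v := by
  rintro ⟨v, hv⟩
  refine hnontriv (hT.exists_forall_smul_eq_of_finite_orbit hauto hnoinv (v := v) ?_)
  have : (MulAction.stabilizer G v).FiniteIndex :=
    Subgroup.finiteIndex_of_le (H := H) fun h hh => hv h hh
  refine Set.finite_of_ncard_ne_zero ?_
  rw [← MulAction.index_stabilizer]
  exact this.index_ne_zero
end
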